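/- Let G be a finite planar simple graph. If there exists an integer a ≥ 3 with a ∈ A(G), then 2 ∈ A(G). -/

import Mathlib

open SimpleGraph

/-- `H` is a minor of `G`: branch-set definition. -/
def SimpleGraph.HasMinor {V W : Type*} (G : SimpleGraph V) (H : SimpleGraph W) : Prop :=
  ∃ f : W → Set V,
    (∀ w, (G.induce (f w)).Connected) ∧
    (Pairwise fun w₁ w₂ => Disjoint (f w₁) (f w₂)) ∧
    ∀ ⦃w₁ w₂⦄, H.Adj w₁ w₂ → ∃ v₁ ∈ f w₁, ∃ v₂ ∈ f w₂, G.Adj v₁ v₂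

/-- Planarity à la Wagner: no `K₅` minor and no `K₃,₃` minor. -/
def SimpleGraph.IsPlanar {V : Type*} (G : SimpleGraph V) : Prop :=
  ¬ G.HasMinor (completeGraph (Fin 5)) ∧
  ¬ G.HasMinor (completeBipartiteGraph (Fin 3) (Fin 3))

/-- `G` is `k`-connected: it has at least `k + 1` vertices, and removing fewer
than `k` vertices always leaves a connected graph. -/
def SimpleGraph.IsKConnected {V : Type*} [Fintype V] (k : ℕ) (G : SimpleGraph V) : Prop :=
  k + 1 ≤ Fintype.card V ∧
  ∀ S : Set V, S.ncard < k → ((⊤ : G.Subgraph).deleteVerts S).coe.Connected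

/-- A polyhedron is a planar, 3-connected (finite simple) graph. -/
def SimpleGraph.IsPolyhedron {V : Type*} [Fintype V] (G : SimpleGraph V) : Prop :=
  G.IsPlanar ∧ G.IsKConnected 3

/-- `A(G)`: the set of numbers of common neighbours of pairs of distinct vertices. -/
def SimpleGraph.commA {V : Type*} (G : SimpleGraph V) : Set ℕ :=
  {a | ∃ u v : V, u ≠ v ∧ (G.commonNeighbors u v).ncard = a}

/-- The vertices that can be reached from `a` by a walk in `G` which avoids `C` after its start. -/
def SimpleGraph.reachAvoiding {V : Type*} (G : SimpleGraph V) (C : Set V) (a : V) : Set V :=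
  {x | Relation.ReflTransGen (fun p q => G.Adj p q ∧ q ∉ C) a x}

namespace SimpleGraph

variable {V : Type*} {G : SimpleGraph V}

theorem self_mem_reachAvoiding (C : Set V) (a : V) : a ∈ G.reachAvoiding C a :=
  Relation.ReflTransGen.refl

theorem mem_reachAvoiding_of_adj {C : Set V} {a x y : V} (hx : x ∈ G.reachAvoiding C a)
    (hxy : G.Adj x y) (hy : y ∉ C) : y ∈ G.reachAvoiding C a :=
  Relation.ReflTransGen.tail hx ⟨hxy, hy⟩

theorem notMem_of_mem_reachAvoiding {C : Set V} {a x : V} (ha : a ∉ C)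
    (hx : x ∈ G.reachAvoiding C a) : x ∉ C := by
  induction hx with
  | refl => exact ha
  | tail _ h _ => exact h.2

theorem connected_induce_reachAvoiding (C : Set V) (a : V) :
    (G.induce (G.reachAvoiding C a)).Connected := by
  have key : ∀ x (hx : x ∈ G.reachAvoiding C a), (G.induce (G.reachAvoiding C a)).Reachable
      ⟨a, self_mem_reachAvoiding C a⟩ ⟨x, hx⟩ := by
    intro x hx
    induction hx with
    | refl => exact Reachable.refl _
    | @tail p q hp hpq ih =>
      refine ih.trans (Adj.reachable ?_)
      exact hpq.1
  exact (connected_iff_exists_forall_reachable _).2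
    ⟨⟨a, self_mem_reachAvoiding C a⟩, fun x => key x.1 x.2⟩

theorem exists_adj_of_mem_reachAvoiding {C : Set V} {a y : V} (hya : y ≠ a)
    (hy : y ∈ G.reachAvoiding C a) : ∃ s ∈ G.reachAvoiding (insert y C) a, G.Adj s y := by
  by_contra! hcon
  have key : ∀ x ∈ G.reachAvoiding C a, x ∈ G.reachAvoiding (insert y C) a := by
    intro x hx
    induction hx with
    | refl => exact self_mem_reachAvoiding _ _
    | @tail p q _ hpq ih =>
      refine mem_reachAvoiding_of_adj ih hpq.1 ?_
      rintro (rfl | hq)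
      · exact hcon p ih hpq.1
      · exact hpq.2 hq
  cases hy with
  | refl => exact hya rfl
  | @tail p _ hp hpq => exact hcon p (key p hp) hpq.1

theorem reachAvoiding_ssubset {C C' : Set V} {c v : V} (hc : c ∉ C) (hv : v ∈ C)
    (hvc : G.Adj v c) (hC' : ∀ x ∈ G.reachAvoiding C c, x ∉ C') :
    G.reachAvoiding C c ⊂ G.reachAvoiding C' v := by
  refine ⟨fun x hx => ?_, fun h => ?_⟩
  · have hx' := hx
    induction hx' with
    | refl => exact mem_reachAvoiding_of_adj (self_mem_reachAvoiding _ _) hvc (hC' _ hx)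
    | @tail p q hp hpq ih => exact mem_reachAvoiding_of_adj (ih hp) hpq.1 (hC' _ hx)
  · exact notMem_of_mem_reachAvoiding hc (h (self_mem_reachAvoiding _ _)) hv

theorem connected_induce_singleton (a : V) : (G.induce ({a} : Set V)).Connected := by
  have : Nonempty ({a} : Set V) := ⟨⟨a, rfl⟩⟩
  exact ⟨Preconnected.of_subsingleton⟩

theorem hasMinor_completeGraph_five {a b c d e : V} (hab : G.Adj a b) (hac : G.Adj a c)
    (had : G.Adj a d) (hae : G.Adj a e) (hbc : G.Adj b c) (hbd : G.Adj b d) (hbe : G.Adj b e)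
    (hcd : G.Adj c d) (hce : G.Adj c e) (hde : G.Adj d e) :
    G.HasMinor (completeGraph (Fin 5)) := by
  have key : ∀ i j : Fin 5, i ≠ j → G.Adj (![a, b, c, d, e] i) (![a, b, c, d, e] j) := by
    intro i j hij
    fin_cases i <;> fin_cases j <;>
      first
      | exact absurd rfl hij
      | assumption
      | (apply Adj.symm; assumption)
  refine ⟨fun i => {![a, b, c, d, e] i}, fun i => connected_induce_singleton _, ?_, ?_⟩
  · intro i j hij
    exact Set.disjoint_singleton.2 (key i j hij).ne
  · intro i j hij
    exact ⟨_, rfl, _, rfl, key i j hij⟩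

/-- Two vertices `u`, `v` with common neighbours `a`, `b`, `c`, and a vertex `y` adjacent to `a`
and `b` and to a connected set which contains `c`, give a `K₃,₃` minor. -/
theorem hasMinor_completeBipartiteGraph_three {u v y a b c : V} {S : Set V}
    (huv : u ≠ v) (hab : a ≠ b) (hyu : y ≠ u) (hyv : y ≠ v)
    (hua : G.Adj u a) (hub : G.Adj u b) (huc : G.Adj u c)
    (hva : G.Adj v a) (hvb : G.Adj v b) (hvc : G.Adj v c)
    (hya : G.Adj y a) (hyb : G.Adj y b) (hcS : c ∈ S) (hyS : ∃ s ∈ S, G.Adj y s)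
    (hS : (G.induce S).Connected) (hu : u ∉ S) (hv : v ∉ S) (hy : y ∉ S) (ha : a ∉ S)
    (hb : b ∉ S) : G.HasMinor (completeBipartiteGraph (Fin 3) (Fin 3)) := by
  have hinl : ∀ i j : Fin 3, i ≠ j → ![u, v, y] i ≠ ![u, v, y] j := by
    intro i j hij
    fin_cases i <;> fin_cases j <;> simp_all [eq_comm]
  have hinr : ∀ i j : Fin 3, i ≠ j → Disjoint (![{a}, {b}, S] i) (![{a}, {b}, S] j) := by
    intro i j hij
    fin_cases i <;> fin_cases j <;> simp_all [eq_comm]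
  have hdis : ∀ i j : Fin 3, ![u, v, y] i ∉ ![{a}, {b}, S] j := by
    intro i j
    fin_cases i <;> fin_cases j <;> simp_all [hua.ne, hub.ne, hva.ne, hvb.ne, hya.ne, hyb.ne]
  have hadj : ∀ i j : Fin 3, ∃ s ∈ ![{a}, {b}, S] j, G.Adj (![u, v, y] i) s := by
    intro i j
    fin_cases i <;> fin_cases j
    · exact ⟨a, rfl, hua⟩
    · exact ⟨b, rfl, hub⟩
    · exact ⟨c, hcS, huc⟩
    · exact ⟨a, rfl, hva⟩
    · exact ⟨b, rfl, hvb⟩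
    · exact ⟨c, hcS, hvc⟩
    · exact ⟨a, rfl, hya⟩
    · exact ⟨b, rfl, hyb⟩
    · exact hyS
  refine ⟨Sum.elim (fun i => {![u, v, y] i}) ![{a}, {b}, S], ?_, ?_, ?_⟩
  · rintro (i | i)
    · exact connected_induce_singleton _
    · fin_cases i
      · exact connected_induce_singleton _
      · exact connected_induce_singleton _
      · exact hS
  · rintro (i | i) (j | j) hij
    · exact Set.disjoint_singleton.2 (hinl i j fun h => hij (congrArg _ h))
    · exact Set.disjoint_singleton_left.2 (hdis i j)
    · exact Set.disjoint_singleton_right.2 (hdis j i)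
    · exact hinr i j fun h => hij (congrArg _ h)
  · rintro (i | i) (j | j) hij
    · simp at hij
    · obtain ⟨s, hs, h⟩ := hadj i j
      exact ⟨_, rfl, s, hs, h⟩
    · obtain ⟨s, hs, h⟩ := hadj j i
      exact ⟨s, hs, _, rfl, h.symm⟩
    · simp at hij

theorem exists_third_commonNeighbor (h2 : 2 ∉ G.commA) {u v a b : V} (huv : u ≠ v) (hab : a ≠ b)
    (hua : G.Adj u a) (hva : G.Adj v a) (hub : G.Adj u b) (hvb : G.Adj v b) :
    ∃ c, c ≠ a ∧ c ≠ b ∧ G.Adj u c ∧ G.Adj v c := by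
  by_contra! hcon
  refine h2 ⟨u, v, huv, ?_⟩
  have : G.commonNeighbors u v = {a, b} := by
    ext c
    simp only [mem_commonNeighbors, Set.mem_insert_iff, Set.mem_singleton_iff]
    constructor
    · rintro ⟨h1, h3⟩
      by_contra! hne
      exact hcon c hne.1 hne.2 h1 h3
    · rintro (rfl | rfl)
      · exact ⟨hua, hva⟩
      · exact ⟨hub, hvb⟩
  rw [this, Set.ncard_pair hab]

/-- If no pair of vertices of a planar graph has exactly two common neighbours, then a common
neighbour `c` of two vertices is adjacent to all their other common neighbours. -/
theorem IsPlanar.adj_and_adj_of_two_notMem_commA [Finite V] (hG : G.IsPlanar) (h2 : 2 ∉ G.commA)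
    {u v a b c : V} (huv : u ≠ v) (hab : a ≠ b) (hac : a ≠ c) (hbc : b ≠ c)
    (hua : G.Adj u a) (hub : G.Adj u b) (huc : G.Adj u c)
    (hva : G.Adj v a) (hvb : G.Adj v b) (hvc : G.Adj v c) : G.Adj c a ∧ G.Adj c b := by
  induction h : (G.reachAvoiding {u, v, a, b} c)ᶜ.ncard using Nat.strong_induction_on
    generalizing u v a b c with
  | _ n ih =>
  subst h
  by_contra hgood
  have hc : c ∉ ({u, v, a, b} : Set V) := by
    simp [huc.ne', hvc.ne', hac.symm, hbc.symm]
  obtain ⟨y, hyu, hyv, hay, hby⟩ :=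
    exists_third_commonNeighbor h2 hab huv hua.symm hub.symm hva.symm hvb.symm
  have hyc : y ≠ c := by
    rintro rfl
    exact hgood ⟨hay.symm, hby.symm⟩
  have hyC : y ∉ ({u, v, a, b} : Set V) := by
    simp [hyu, hyv, hay.ne', hby.ne']
  have hyO : y ∉ G.reachAvoiding {u, v, a, b} c := by
    intro hy
    obtain ⟨s, hs, hsy⟩ := exists_adj_of_mem_reachAvoiding hyc hy
    have hS : ∀ x ∈ insert y ({u, v, a, b} : Set V),
        x ∉ G.reachAvoiding (insert y {u, v, a, b}) c := fun x hx hx' =>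
      notMem_of_mem_reachAvoiding (by
        rw [Set.mem_insert_iff, not_or]
        exact ⟨hyc.symm, hc⟩) hx' hx
    exact hG.2 (hasMinor_completeBipartiteGraph_three huv hab hyu hyv hua hub huc hva hvb hvc
      hay.symm hby.symm (self_mem_reachAvoiding _ c) ⟨s, hs, hsy.symm⟩
      (connected_induce_reachAvoiding _ c) (hS u (by simp)) (hS v (by simp)) (hS y (by simp))
      (hS a (by simp)) (hS b (by simp)))
  have hOC : ∀ x ∈ G.reachAvoiding {u, v, a, b} c, x ≠ u ∧ x ≠ v ∧ x ≠ a ∧ x ≠ b ∧ x ≠ y := by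
    intro x hx
    have := notMem_of_mem_reachAvoiding hc hx
    simp only [Set.mem_insert_iff, Set.mem_singleton_iff, not_or] at this
    exact ⟨this.1, this.2.1, this.2.2.1, this.2.2.2, fun h => hyO (h ▸ hx)⟩
  have hlt : ∀ {w : V} {C' : Set V}, w ∈ ({u, v, a, b} : Set V) → G.Adj w c →
      (∀ x ∈ G.reachAvoiding {u, v, a, b} c, x ∉ C') →
      (G.reachAvoiding C' w)ᶜ.ncard < (G.reachAvoiding {u, v, a, b} c)ᶜ.ncard := by
    intro w C' hw hwc hC'
    exact Set.ncard_lt_ncard (compl_lt_compl_iff_lt.2 (reachAvoiding_ssubset hc hw hwc hC'))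
      (Set.toFinite _)
  obtain ⟨hvu, hvy⟩ := ih _ (hlt (w := v) (C' := {a, b, u, y}) (by simp) hvc (by
    intro x hx
    have := hOC x hx
    simp [this])) hab hyu.symm huv hyv hua.symm hay hva.symm hub.symm hby hvb.symm rfl
  obtain ⟨-, huy⟩ := ih _ (hlt (w := u) (C' := {a, b, v, y}) (by simp) huc (by
    intro x hx
    have := hOC x hx
    simp [this])) hab hyv.symm huv.symm hyu hva.symm hay hua.symm hvb.symm hby hub.symm rfl
  obtain ⟨t, htu, htv, hat, hyt⟩ :=
    exists_third_commonNeighbor h2 hay.ne huv hua.symm huy.symm hva.symm hvy.symm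
  have htO : ∀ x ∈ G.reachAvoiding {u, v, a, b} c, x ≠ t := by
    rintro x hx rfl
    exact hyO (mem_reachAvoiding_of_adj hx hyt.symm hyC)
  obtain ⟨-, hvt⟩ := ih _ (hlt (w := v) (C' := {a, y, u, t}) (by simp) hvc (by
    intro x hx
    have := hOC x hx
    have := htO x hx
    simp_all)) hay.ne htu.symm huv htv hua.symm hat hva.symm huy.symm hyt hvy.symm rfl
  obtain ⟨-, hut⟩ := ih _ (hlt (w := u) (C' := {a, y, v, t}) (by simp) huc (by
    intro x hx
    have := hOC x hx
    have := htO x hx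
    simp_all)) hay.ne htv.symm huv.symm htu hva.symm hat hua.symm hvy.symm hyt huy.symm rfl
  exact hG.1 (hasMinor_completeGraph_five hvu hvy hva hvt huy hua hut hay.symm hyt hat)

end SimpleGraph

/-- If a finite planar graph `G` has some `a ≥ 3` in `A(G)`,
then `2 ∈ A(G)`. -/
theorem stmt1 {V : Type*} [Fintype V] (G : SimpleGraph V)
    (hG : G.IsPlanar) (h : ∃ a : ℕ, 3 ≤ a ∧ a ∈ G.commA) :
    2 ∈ G.commA := by
  by_contra h2
  obtain ⟨n, hn, u, v, huv, rfl⟩ := h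
  obtain ⟨a, ha, b, hb, c, hc, hab, hac, hbc⟩ := (Set.two_lt_ncard (Set.toFinite _)).1 hn
  rw [mem_commonNeighbors] at ha hb hc
  obtain ⟨hca, hcb⟩ := hG.adj_and_adj_of_two_notMem_commA h2 huv hab hac hbc
    ha.1 hb.1 hc.1 ha.2 hb.2 hc.2
  obtain ⟨hba, -⟩ := hG.adj_and_adj_of_two_notMem_commA h2 huv hac hab hbc.symm
    ha.1 hc.1 hb.1 ha.2 hc.2 hb.2
  obtain ⟨t, htb, htc, hut, hat⟩ :=
    exists_third_commonNeighbor h2 ha.1.ne hbc hb.1 hba.symm hc.1 hca.symm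
  have htv : t ≠ v := by
    rintro rfl
    exact hG.1 (hasMinor_completeGraph_five hut ha.1 hb.1 hc.1 ha.2 hb.2 hc.2 hba.symm
      hca.symm hcb.symm)
  obtain ⟨htb', htc'⟩ := hG.adj_and_adj_of_two_notMem_commA h2 ha.1.ne hbc htb.symm htc.symm
    hb.1 hc.1 hut hba.symm hca.symm hat
  refine hG.2 (hasMinor_completeBipartiteGraph_three (S := {c}) huv hab hut.ne' htv ha.1 hb.1 hc.1
    ha.2 hb.2 hc.2 hat.symm htb' rfl ⟨c, rfl, htc'⟩ (connected_induce_singleton c)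
    hc.1.ne hc.2.ne htc hac hbc)
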